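/- Let K be a CM-field with maximal totally real subfield k. Then the quotient group S_K/Tor(K^×) is a free abelian group which is not finitely generated, where S_K is the kernel of N_{K/k} : K^× → k^×. -/

import Mathlib

/-- The relative norm `N_{K/k}(β) = β·τ(β)` as a homomorphism of unit groups. -/
noncomputable def relNormHom (k K : Type) [Field k] [Field K] [Algebra k K]
    (τ : K ≃ₐ[k] K) : Kˣ →* Kˣ where
  toFun β := β * Units.map (τ : K →+* K).toMonoidHom β
  map_one' := by simp
  map_mul' a b := by simp [map_mul, mul_mul_mul_comm]

theorem free_of_submodule_finsupp {ι : Type} [LinearOrder ι] [WellFoundedLT ι]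
    (N : Submodule ℤ (ι →₀ ℤ)) : Module.Free ℤ N := by
  classical
  let F : ι → Submodule ℤ (ι →₀ ℤ) := fun i => N ⊓ Finsupp.supported ℤ ℤ (Set.Iic i)
  let J : ι → Submodule ℤ ℤ := fun i => (F i).map (Finsupp.lapply i)
  have hJ : ∀ i, ∃ f ∈ F i, J i = Submodule.span ℤ {f i} := by
    intro i
    obtain ⟨a, ha⟩ := (IsPrincipalIdealRing.principal (J i)).principal
    have : a ∈ J i := by rw [ha]; exact Submodule.mem_span_singleton_self a
    obtain ⟨f, hf, hfa⟩ := this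
    refine ⟨f, hf, ?_⟩
    rw [ha, ← hfa]; rfl
  choose f hf hfJ using hJ
  let I := {i : ι // f i i ≠ 0}
  let b : I → N := fun i => ⟨f i.1, (hf i.1).1⟩
  have hzero : ∀ i j, i < j → f i j = 0 := by
    intro i j hij
    have h := (hf i).2
    rw [SetLike.mem_coe, Finsupp.mem_supported'] at h
    exact h j (by simpa using hij)
  have hli : LinearIndependent ℤ b := by
    rw [linearIndependent_iff]
    intro l hl
    by_contra hne
    have hs : l.support.Nonempty := Finsupp.support_nonempty_iff.mpr hne
    obtain ⟨m, hm, hmax⟩ := l.support.exists_max_image (fun i => i.1) hs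
    have h1 : (Finsupp.lapply m.1 : (ι →₀ ℤ) →ₗ[ℤ] ℤ) (N.subtype (Finsupp.linearCombination ℤ b l)) = 0 := by
      rw [hl]; simp
    rw [Finsupp.linearCombination_apply, Finsupp.sum, map_sum, map_sum,
      Finset.sum_eq_single_of_mem m hm] at h1
    · simp [b] at h1
      rcases h1 with h1 | h1
      · exact (Finsupp.mem_support_iff.mp hm) h1
      · exact m.2 h1
    · intro j hj hjm
      have hlt : j.1 < m.1 := lt_of_le_of_ne (hmax j hj) (fun h => hjm (Subtype.ext h))
      simp [b, hzero _ _ hlt]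
  have hspan : ∀ i, ∀ x (hx : x ∈ F i), (⟨x, hx.1⟩ : N) ∈ Submodule.span ℤ (Set.range b) := by
    intro i
    induction i using WellFoundedLT.induction with
    | ind i ih =>
    intro x hx
    have hxi : x i ∈ J i := ⟨x, hx, rfl⟩
    rw [hfJ i, Submodule.mem_span_singleton] at hxi
    obtain ⟨c, hc⟩ := hxi
    have hkey : ∀ y (hy : y ∈ F i), y i = 0 → (⟨y, hy.1⟩ : N) ∈ Submodule.span ℤ (Set.range b) := by
      intro y hy hyi
      by_cases h0 : y = 0
      · subst h0
        exact Submodule.zero_mem _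
      have hs : y.support.Nonempty := Finsupp.support_nonempty_iff.mpr h0
      have hm := y.support.max'_mem hs
      set m := y.support.max' hs with hmdef
      have hmi : m ≤ i := by
        have := (Finsupp.mem_supported ℤ y).mp hy.2
        exact this hm
      have hne : m ≠ i := by
        intro h
        rw [h] at hm
        exact (Finsupp.mem_support_iff.mp hm) hyi
      refine ih m (lt_of_le_of_ne hmi hne) y ⟨hy.1, ?_⟩
      rw [SetLike.mem_coe, Finsupp.mem_supported]
      intro j hj
      exact y.support.le_max' j hj
    by_cases hfi : f i i = 0
    · apply hkey x hx
      rw [← hc, hfi]; simp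
    · have h1 := hkey (x - c • f i) (Submodule.sub_mem _ hx (Submodule.smul_mem _ _ (hf i)))
        (by simp [← hc])
      have h2 : c • b ⟨i, hfi⟩ ∈ Submodule.span ℤ (Set.range b) :=
        Submodule.smul_mem _ _ (Submodule.subset_span ⟨_, rfl⟩)
      have h3 := Submodule.add_mem _ h1 h2
      convert h3 using 1
      ext1
      simp [b]
  refine Module.Free.of_basis (Module.Basis.mk hli ?_)
  rintro ⟨x, hx⟩ -
  by_cases h0 : x = 0
  · subst h0
    exact Submodule.zero_mem _
  have hs : x.support.Nonempty := Finsupp.support_nonempty_iff.mpr h0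
  refine hspan (x.support.max' hs) x ⟨hx, ?_⟩
  rw [SetLike.mem_coe, Finsupp.mem_supported]
  intro j hj
  exact x.support.le_max' j hj

open IsDedekindDomain FractionalIdeal nonZeroDivisors NumberField in
/-- The vector of valuations of an element of `Kˣ` at all finite primes. -/
noncomputable def valHom (K : Type) [Field K] [NumberField K] :
    Kˣ →* Multiplicative (HeightOneSpectrum (𝓞 K) →₀ ℤ) where
  toFun x := Multiplicative.ofAdd (Finsupp.ofSupportFinite
    (fun v => count K v (spanSingleton (𝓞 K)⁰ (x : K)))
    (finite_factors (spanSingleton (𝓞 K)⁰ (x : K))))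
  map_one' := by
    apply Multiplicative.toAdd.injective
    ext v
    simp [Finsupp.ofSupportFinite, count_one]
  map_mul' x y := by
    apply Multiplicative.toAdd.injective
    ext v
    have hx : spanSingleton (𝓞 K)⁰ (x : K) ≠ 0 :=
      spanSingleton_ne_zero_iff.mpr x.ne_zero
    have hy : spanSingleton (𝓞 K)⁰ (y : K) ≠ 0 :=
      spanSingleton_ne_zero_iff.mpr y.ne_zero
    rw [toAdd_mul, Finsupp.add_apply]
    change count K v (spanSingleton (𝓞 K)⁰ ((x * y : Kˣ) : K)) =
      count K v (spanSingleton (𝓞 K)⁰ (x : K)) + count K v (spanSingleton (𝓞 K)⁰ (y : K))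
    rw [Units.val_mul, ← spanSingleton_mul_spanSingleton, count_mul K v hx hy]

open IsDedekindDomain FractionalIdeal nonZeroDivisors NumberField in
theorem valHom_apply (K : Type) [Field K] [NumberField K] (x : Kˣ) (v : HeightOneSpectrum (𝓞 K)) :
    (valHom K x).toAdd v = count K v (spanSingleton (𝓞 K)⁰ (x : K)) := rfl

open IsDedekindDomain FractionalIdeal nonZeroDivisors NumberField in
theorem isIntegral_of_valHom (K : Type) [Field K] [NumberField K] (x : Kˣ) (h : valHom K x = 1) :
    IsIntegral ℤ (x : K) := by
  have h0 : ∀ v, count K v (spanSingleton (𝓞 K)⁰ (x : K)) = 0 := by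
    intro v
    rw [← valHom_apply, h]; rfl
  have hx : spanSingleton (𝓞 K)⁰ (x : K) ≠ 0 :=
      spanSingleton_ne_zero_iff.mpr x.ne_zero
  have h1 := finprod_heightOneSpectrum_factorization' K hx
  simp only [h0, zpow_zero, finprod_one] at h1
  have h2 : (x : K) ∈ (1 : FractionalIdeal (𝓞 K)⁰ K) := by
    rw [h1]; exact mem_spanSingleton_self _ _
  rw [mem_one_iff] at h2
  obtain ⟨y, hy⟩ := h2
  rw [← hy]
  exact RingOfIntegers.isIntegral_coe y

open IsDedekindDomain FractionalIdeal nonZeroDivisors NumberField in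
theorem valHom_ne_zero_iff (K : Type) [Field K] [NumberField K] (x : Kˣ) (y : 𝓞 K)
    (hxy : algebraMap (𝓞 K) K y = x) (v : HeightOneSpectrum (𝓞 K)) :
    (valHom K x).toAdd v ≠ 0 ↔ y ∈ v.asIdeal := by
  classical
  have hy : y ≠ 0 := by
    rintro rfl
    exact x.ne_zero (by rw [← hxy, map_zero])
  have hI : Ideal.span {y} ≠ 0 := by simpa using hy
  rw [valHom_apply, ← hxy, ← coeIdeal_span_singleton, count_coe K v hI, Nat.cast_ne_zero,
    Associates.count_ne_zero_iff_dvd hI v.irreducible, Ideal.dvd_span_singleton]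

open IsDedekindDomain NumberField in
/-- Outside any finite set of primes, some element of the kernel of the norm has a nonzero
valuation. -/
theorem exists_support (k K : Type) [Field k] [Field K] [NumberField K]
    [Algebra k K] (τ : K ≃ₐ[k] K) (hτ : τ ≠ (AlgEquiv.refl : K ≃ₐ[k] K))
    (hconj : ∀ σ : K →+* ℂ, ∀ x : K, σ (τ x) = (starRingEnd ℂ) (σ x))
    (T : Finset (HeightOneSpectrum (𝓞 K))) :
    ∃ x ∈ (relNormHom k K τ).ker, ∃ v ∉ T, (valHom K x).toAdd v ≠ 0 := by
  classical
  obtain ⟨σ₀⟩ : Nonempty (K →+* ℂ) := inferInstance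
  have hinv : ∀ x, τ (τ x) = x := by
    intro x
    apply σ₀.injective
    rw [hconj, hconj, Complex.conj_conj]
  obtain ⟨d, hd⟩ : ∃ d, τ d ≠ d := by
    by_contra! h
    exact hτ (AlgEquiv.ext h)
  -- an integral, nonzero, purely imaginary element
  obtain ⟨γ, hγ0, hγτ⟩ : ∃ γ : 𝓞 K, γ ≠ 0 ∧ τ (γ : K) = -(γ : K) := by
    obtain ⟨m, hm0, hm⟩ := exists_integral_multiples ℤ ℚ ({d - τ d} : Finset K)
    have hm' := hm (d - τ d) (by simp)
    refine ⟨⟨m • (d - τ d), hm'⟩, ?_, ?_⟩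
    · intro h
      have h' := congrArg (algebraMap (𝓞 K) K) h
      have h'' : m • (d - τ d) = 0 := h'
      rcases smul_eq_zero.mp h'' with h | h
      · exact hm0 h
      · exact hd (sub_eq_zero.mp h).symm
    · change τ (m • (d - τ d)) = -(m • (d - τ d))
      rw [map_zsmul, map_sub, hinv, ← smul_neg, neg_sub]
  let M : ℕ := 2 * ∏ P ∈ T, Ideal.absNorm P.asIdeal
  have hM0 : M ≠ 0 := by
    refine mul_ne_zero two_ne_zero (Finset.prod_ne_zero_iff.mpr fun P _ => ?_)
    rw [Ne, Ideal.absNorm_eq_zero_iff]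
    exact P.ne_bot
  have hM2 : ∀ P : HeightOneSpectrum (𝓞 K), (2 : 𝓞 K) ∈ P.asIdeal → (M : 𝓞 K) ∈ P.asIdeal := by
    intro P hP
    simp only [M, Nat.cast_mul, Nat.cast_ofNat]
    exact Ideal.mul_mem_right _ _ hP
  have hMT : ∀ P ∈ T, (M : 𝓞 K) ∈ P.asIdeal := by
    intro P hP
    simp only [M, Nat.cast_mul, Nat.cast_prod]
    rw [← Finset.mul_prod_erase T _ hP]
    exact Ideal.mul_mem_left _ _ (Ideal.mul_mem_right _ _ (Ideal.absNorm_mem P.asIdeal))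
  let a : 𝓞 K := 1 - M * γ
  let b : 𝓞 K := 1 + M * γ
  have hτa : τ (a : K) = (b : K) := by
    simp [a, b, hγτ]
  have hτb : τ (b : K) = (a : K) := by
    rw [← hτa, hinv]
  have hnorm : ∀ σ : K →+* ℂ, 1 < ‖σ (a : K)‖ := by
    intro σ
    have hre : (σ (γ : K)).re = 0 := by
      have h := hconj σ γ
      rw [hγτ, map_neg] at h
      have := congrArg Complex.re h
      simp only [Complex.neg_re, Complex.conj_re] at this
      linarith
    have him : (σ (γ : K)).im ≠ 0 := by
      intro h
      have : σ (γ : K) = 0 := Complex.ext hre h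
      rw [map_eq_zero] at this
      exact hγ0 (by exact_mod_cast this)
    have hsq : 1 < Complex.normSq (σ (a : K)) := by
      have hM : (M : ℝ) ≠ 0 := by exact_mod_cast hM0
      have : Complex.normSq (σ (a : K)) = 1 + ((M : ℝ) * (σ (γ : K)).im) ^ 2 := by
        simp [a, Complex.normSq_apply, hre]
        ring
      rw [this]
      have : 0 < ((M : ℝ) * (σ (γ : K)).im) ^ 2 := by positivity
      linarith
    rw [Complex.normSq_eq_norm_sq] at hsq
    nlinarith [norm_nonneg (σ (a : K))]
  have ha0 : (a : K) ≠ 0 := by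
    intro h
    have := hnorm σ₀
    rw [h] at this
    norm_num at this
  have hb0 : (b : K) ≠ 0 := by
    rw [← hτa]; simpa using ha0
  have hnu : ¬ IsUnit a := by
    intro hu
    obtain ⟨c, hc⟩ := hu.exists_right_inv
    have hcK : (a : K) * (c : K) = 1 := by
      have := congrArg (algebraMap (𝓞 K) K) hc
      simpa using this
    have hcn : ∀ σ : K →+* ℂ, ‖σ (c : K)‖ < 1 := by
      intro σ
      have h1 : ‖σ (a : K)‖ * ‖σ (c : K)‖ = 1 := by
        rw [← norm_mul, ← map_mul, hcK, map_one, norm_one]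
      have := hnorm σ
      by_contra! hge
      nlinarith
    have hc0 : (c : K) ≠ 0 := right_ne_zero_of_mul_eq_one hcK
    obtain ⟨n, hn, hcn1⟩ := NumberField.Embeddings.pow_eq_one_of_norm_le_one K ℂ hc0
      (RingOfIntegers.isIntegral_coe c) (fun σ => (hcn σ).le)
    have h1 : ‖σ₀ (c : K)‖ ^ n = 1 := by
      rw [← norm_pow, ← map_pow, hcn1, map_one, norm_one]
    have h2 : ‖σ₀ (c : K)‖ ^ n < 1 := pow_lt_one₀ (norm_nonneg _) (hcn σ₀) hn.ne'
    linarith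
  obtain ⟨p, hpmax, hap⟩ := exists_max_ideal_of_mem_nonunits (a := a) hnu
  let P : HeightOneSpectrum (𝓞 K) := ⟨p, hpmax.isPrime, by
    rintro rfl
    exact ha0 (by rw [Ideal.mem_bot.mp hap]; simp)⟩
  have hapP : a ∈ P.asIdeal := hap
  have hMP : (M : 𝓞 K) ∉ P.asIdeal := by
    intro h
    apply P.isPrime.ne_top
    rw [Ideal.eq_top_iff_one]
    have : (1 : 𝓞 K) = a + M * γ := by simp [a]
    rw [this]
    exact Ideal.add_mem _ hapP (Ideal.mul_mem_right _ _ h)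
  have hbP : b ∉ P.asIdeal := by
    intro h
    apply hMP
    apply hM2
    have : (2 : 𝓞 K) = a + b := by simp only [a, b]; ring
    rw [this]
    exact Ideal.add_mem _ hapP h
  let ua : Kˣ := Units.mk0 _ ha0
  let ub : Kˣ := Units.mk0 _ hb0
  refine ⟨ua * ub⁻¹, ?_, P, fun h => hMP (hMT P h), ?_⟩
  · rw [MonoidHom.mem_ker]
    ext
    simp only [relNormHom, MonoidHom.coe_mk, OneHom.coe_mk, Units.val_mul, Units.coe_map,
      Units.val_inv_eq_inv_val, Units.val_one]
    change (a : K) * (b : K)⁻¹ * τ ((a : K) * (b : K)⁻¹) = 1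
    rw [map_mul, map_inv₀, hτa, hτb]
    field_simp
  · have h1 := (valHom_ne_zero_iff K ua a rfl P).mpr hapP
    have h2 : (valHom K ub).toAdd P = 0 := by
      by_contra h
      exact hbP ((valHom_ne_zero_iff K ub b rfl P).mp h)
    rw [map_mul, map_inv, toAdd_mul, toAdd_inv, Finsupp.add_apply, Finsupp.neg_apply, h2]
    simpa using h1

theorem ker_valHom (k K : Type) [Field k] [Field K] [NumberField K]
    [Algebra k K] (τ : K ≃ₐ[k] K)
    (hconj : ∀ σ : K →+* ℂ, ∀ x : K, σ (τ x) = (starRingEnd ℂ) (σ x)) :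
    (CommGroup.torsion Kˣ).subgroupOf (relNormHom k K τ).ker =
      ((valHom K).comp (relNormHom k K τ).ker.subtype).ker := by
  ext ⟨x, hx⟩
  rw [Subgroup.mem_subgroupOf, MonoidHom.mem_ker, CommGroup.mem_torsion, isOfFinOrder_iff_pow_eq_one]
  change (∃ n : ℕ, 0 < n ∧ x ^ n = 1) ↔ valHom K x = 1
  constructor
  · rintro ⟨n, hn, hxn⟩
    have h1 : (valHom K x) ^ n = 1 := by rw [← map_pow, hxn, map_one]
    apply Multiplicative.toAdd.injective
    have h2 := congrArg Multiplicative.toAdd h1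
    rw [toAdd_pow, toAdd_one] at h2
    rw [toAdd_one]
    exact (smul_eq_zero.mp h2).resolve_left hn.ne'
  · intro h
    have hi := isIntegral_of_valHom K x h
    have hn : ∀ σ : K →+* ℂ, ‖σ (x : K)‖ = 1 := by
      intro σ
      have hx1 : (x : K) * τ (x : K) = 1 := by
        have := congrArg Units.val (MonoidHom.mem_ker.mp hx)
        simpa [relNormHom] using this
      have h2 := congrArg (fun z => ‖σ z‖) hx1
      simp only [map_mul, hconj, norm_mul, RCLike.norm_conj, map_one, norm_one] at h2
      nlinarith [norm_nonneg (σ (x : K))]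
    obtain ⟨n, hn, hxn⟩ := NumberField.Embeddings.pow_eq_one_of_norm_eq_one K ℂ hi hn
    exact ⟨n, hn, by ext; simpa using hxn⟩

/-- Let `K` be a CM-field with maximal totally real subfield `k`.  Then the quotient
`S_K/Tor(K^×)` is a free abelian group which is not finitely generated, where
`S_K = ker(N_{K/k} : K^× → k^×)`. -/
theorem stmt16 (k K : Type) [Field k] [NumberField k] [Field K] [NumberField K]
    [Algebra k K]
    (hreal : ∀ φ : k →+* ℂ, ∀ x : k, (φ x).im = 0)
    (hdeg : Module.finrank k K = 2)
    (τ : K ≃ₐ[k] K) (hτ : τ ≠ (AlgEquiv.refl : K ≃ₐ[k] K))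
    (hconj : ∀ σ : K →+* ℂ, ∀ x : K, σ (τ x) = (starRingEnd ℂ) (σ x)) :
    (∃ ι : Type, Nonempty
        (((relNormHom k K τ).ker ⧸
            (CommGroup.torsion Kˣ).subgroupOf (relNormHom k K τ).ker) ≃*
          Multiplicative (ι →₀ ℤ))) ∧
      ¬ Group.FG ((relNormHom k K τ).ker ⧸
          (CommGroup.torsion Kˣ).subgroupOf (relNormHom k K τ).ker) := by
  classical
  let g := (valHom K).comp (relNormHom k K τ).ker.subtype
  let e : ((relNormHom k K τ).ker ⧸
      (CommGroup.torsion Kˣ).subgroupOf (relNormHom k K τ).ker) ≃* g.range :=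
    (QuotientGroup.quotientMulEquivOfEq (ker_valHom k K τ hconj)).trans
      (QuotientGroup.quotientKerEquivRange g)
  constructor
  · letI : LinearOrder (IsDedekindDomain.HeightOneSpectrum (NumberField.RingOfIntegers K)) :=
      IsWellOrder.linearOrder WellOrderingRel
    haveI : WellFoundedLT (IsDedekindDomain.HeightOneSpectrum (NumberField.RingOfIntegers K)) :=
      ⟨(inferInstance : IsWellFounded _ WellOrderingRel).wf⟩
    let A : AddSubgroup (IsDedekindDomain.HeightOneSpectrum (NumberField.RingOfIntegers K) →₀ ℤ) :=
      Subgroup.toAddSubgroup' g.range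
    let N := AddSubgroup.toIntSubmodule A
    haveI : Module.Free ℤ N := free_of_submodule_finsupp N
    let e2 : g.range ≃* Multiplicative N :=
      { toFun := fun x => Multiplicative.ofAdd ⟨x.1.toAdd, x.2⟩
        invFun := fun y => ⟨Multiplicative.ofAdd y.toAdd.1, y.toAdd.2⟩
        left_inv := fun _ => rfl
        right_inv := fun _ => rfl
        map_mul' := fun _ _ => rfl }
    exact ⟨Module.Free.ChooseBasisIndex ℤ N, ⟨(e.trans e2).trans
      (AddEquiv.toMultiplicative (Module.Free.chooseBasis ℤ N).repr.toAddEquiv)⟩⟩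
  · intro hfg
    have h1 : Group.FG g.range := Group.fg_of_surjective (f := e.toMonoidHom) e.surjective
    rw [Group.fg_iff_subgroup_fg] at h1
    obtain ⟨s, hs⟩ := h1
    obtain ⟨x, hx, v, hv, hne⟩ := exists_support k K τ hτ hconj
      (s.biUnion fun y => y.toAdd.support)
    have hmem : valHom K x ∈ Subgroup.closure (s : Set (Multiplicative _)) := by
      rw [hs]; exact ⟨⟨x, hx⟩, rfl⟩
    apply hne
    clear hne
    generalize valHom K x = w at hmem ⊢
    induction hmem using Subgroup.closure_induction with
    | mem y hy =>
      by_contra h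
      exact hv (Finset.mem_biUnion.mpr ⟨y, hy, Finsupp.mem_support_iff.mpr h⟩)
    | one => rfl
    | mul y z _ _ hy hz => rw [toAdd_mul, Finsupp.add_apply, hy, hz, add_zero]
    | inv y _ hy => rw [toAdd_inv, Finsupp.neg_apply, hy, neg_zero]
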